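/- Let 1 ≤ p < ∞ and let φ : ℝⁿ × (0,∞) → (0,∞) satisfy the doubling condition (D). With Φ*(x,r) = ∫₁^{max(2,|x|,r)} φ(0,t)/t dt and Φ**(x,r) = ∫_r^{max(2,|x|,r)} φ(x,t)/t dt, one has the continuous inclusion 𝓛𝓝_{p,φ}(ℝⁿ) ⊂ L_{p,Φ*+Φ**}(ℝⁿ): there is a constant C with ‖f‖_{L_{p,Φ*+Φ**}} ≤ C‖f‖_{𝓛𝓝_{p,φ}} for all f ∈ 𝓛𝓝_{p,φ}(ℝⁿ). -/

import Mathlib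

open MeasureTheory Metric Filter
open scoped ENNReal NNReal

noncomputable section

/-- Average of `f` over the ball `B(x,r)`. -/
def ballAvg {n : ℕ} (f : EuclideanSpace ℝ (Fin n) → ℝ) (x : EuclideanSpace ℝ (Fin n))
    (r : ℝ) : ℝ :=
  (volume (ball x r)).toReal⁻¹ * ∫ y in ball x r, f y

/-- Campanato seminorm with variable growth function `φ`. -/
def campSemi {n : ℕ} (p : ℝ) (φ : EuclideanSpace ℝ (Fin n) → ℝ → ℝ)
    (f : EuclideanSpace ℝ (Fin n) → ℝ) : ℝ≥0∞ :=
  ⨆ (x : EuclideanSpace ℝ (Fin n)) (r : ℝ) (_ : 0 < r),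
    ENNReal.ofReal ((φ x r)⁻¹ *
      ((volume (ball x r)).toReal⁻¹ * ∫ y in ball x r, |f y - ballAvg f x r| ^ p) ^ (1 / p))

/-- Campanato norm: seminorm plus `|f_{B(0,1)}|`. -/
def campNorm {n : ℕ} (p : ℝ) (φ : EuclideanSpace ℝ (Fin n) → ℝ → ℝ)
    (f : EuclideanSpace ℝ (Fin n) → ℝ) : ℝ≥0∞ :=
  campSemi p φ f + ENNReal.ofReal |ballAvg f 0 1|

/-- Morrey norm with variable growth function `φ`. -/
def morreyNorm {n : ℕ} (p : ℝ) (φ : EuclideanSpace ℝ (Fin n) → ℝ → ℝ)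
    (f : EuclideanSpace ℝ (Fin n) → ℝ) : ℝ≥0∞ :=
  ⨆ (x : EuclideanSpace ℝ (Fin n)) (r : ℝ) (_ : 0 < r),
    ENNReal.ofReal ((φ x r)⁻¹ *
      ((volume (ball x r)).toReal⁻¹ * ∫ y in ball x r, |f y| ^ p) ^ (1 / p))

/-- Hölder seminorm with variable growth function `φ`. -/
def holderSemi {n : ℕ} (φ : EuclideanSpace ℝ (Fin n) → ℝ → ℝ)
    (f : EuclideanSpace ℝ (Fin n) → ℝ) : ℝ≥0∞ :=
  ⨆ (x : EuclideanSpace ℝ (Fin n)) (y : EuclideanSpace ℝ (Fin n)) (_ : x ≠ y),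
    ENNReal.ofReal (2 * |f x - f y| / (φ x (dist x y) + φ y (dist x y)))

/-- The doubling condition (D) with constant `A`. -/
def DoublingWith {n : ℕ} (A : ℝ) (φ : EuclideanSpace ℝ (Fin n) → ℝ → ℝ) : Prop :=
  ∀ (x : EuclideanSpace ℝ (Fin n)) (r s : ℝ), 0 < r → 0 < s →
    1 / 2 ≤ s / r → s / r ≤ 2 → A⁻¹ ≤ φ x s / φ x r ∧ φ x s / φ x r ≤ A

/-- The doubling condition (D). -/
def Doubling {n : ℕ} (φ : EuclideanSpace ℝ (Fin n) → ℝ → ℝ) : Prop :=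
  ∃ A > 0, DoublingWith A φ

/-- The nearness condition (N). -/
def Nearness {n : ℕ} (φ : EuclideanSpace ℝ (Fin n) → ℝ → ℝ) : Prop :=
  ∃ A > 0, ∀ (x y : EuclideanSpace ℝ (Fin n)) (r : ℝ), 0 < r → dist x y ≤ r →
    A⁻¹ ≤ φ x r / φ y r ∧ φ x r / φ y r ≤ A

/-- The almost increasing condition (I). -/
def AlmostIncreasing {n : ℕ} (φ : EuclideanSpace ℝ (Fin n) → ℝ → ℝ) : Prop :=
  ∃ A > 0, ∀ (x : EuclideanSpace ℝ (Fin n)) (r s : ℝ), 0 < r → r < s → φ x r ≤ A * φ x s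

/-- Positivity of the variable growth function. -/
def GrowthPos {n : ℕ} (φ : EuclideanSpace ℝ (Fin n) → ℝ → ℝ) : Prop :=
  ∀ (x : EuclideanSpace ℝ (Fin n)) (r : ℝ), 0 < r → 0 < φ x r

/-- `f ∈ L^p_loc(ℝⁿ)` (in particular `f ∈ L¹_loc`). -/
def MemLpLoc {n : ℕ} (p : ℝ) (f : EuclideanSpace ℝ (Fin n) → ℝ) : Prop :=
  LocallyIntegrable f volume ∧
    ∀ (x : EuclideanSpace ℝ (Fin n)) (r : ℝ), 0 < r →
      IntegrableOn (fun y => |f y| ^ p) (ball x r) volume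


/-- `Φ*(x,r) = ∫₁^{max(2,|x|,r)} φ(0,t)/t dt`. -/
def PhiStar {n : ℕ} (φ : EuclideanSpace ℝ (Fin n) → ℝ → ℝ)
    (x : EuclideanSpace ℝ (Fin n)) (r : ℝ) : ℝ :=
  ∫ t in (1 : ℝ)..(max 2 (max ‖x‖ r)), φ 0 t / t

/-- `Φ**(x,r) = ∫_r^{max(2,|x|,r)} φ(x,t)/t dt`. -/
def PhiStarStar {n : ℕ} (φ : EuclideanSpace ℝ (Fin n) → ℝ → ℝ)
    (x : EuclideanSpace ℝ (Fin n)) (r : ℝ) : ℝ :=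
  ∫ t in r..(max 2 (max ‖x‖ r)), φ x t / t

/-- p-mean oscillation around a constant. -/
def pMean {n : ℕ} (p : ℝ) (f : EuclideanSpace ℝ (Fin n) → ℝ) (x : EuclideanSpace ℝ (Fin n))
    (r c : ℝ) : ℝ :=
  ((volume (ball x r)).toReal⁻¹ * ∫ y in ball x r, |f y - c| ^ p) ^ (1 / p)

/-- normalized measure. -/
def bMeas {n : ℕ} (x : EuclideanSpace ℝ (Fin n)) (r : ℝ) : Measure (EuclideanSpace ℝ (Fin n)) :=
  (volume (ball x r))⁻¹ • volume.restrict (ball x r)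

lemma bMeas_prob {n : ℕ} (x : EuclideanSpace ℝ (Fin n)) {r : ℝ} (hr : 0 < r) :
    IsProbabilityMeasure (bMeas x r) := by
  constructor
  simp only [bMeas, Measure.smul_apply, Measure.restrict_apply_univ, smul_eq_mul]
  exact ENNReal.inv_mul_cancel (measure_ball_pos _ _ hr).ne' measure_ball_lt_top.ne

lemma vol_pos {n : ℕ} (x : EuclideanSpace ℝ (Fin n)) {r : ℝ} (hr : 0 < r) :
    0 < (volume (ball x r)).toReal :=
  ENNReal.toReal_pos (measure_ball_pos _ _ hr).ne' measure_ball_lt_top.ne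

lemma memLp_restrict {n : ℕ} {p : ℝ} (hp : 1 ≤ p) {f : EuclideanSpace ℝ (Fin n) → ℝ}
    (hf : MemLpLoc p f) (x : EuclideanSpace ℝ (Fin n)) {r : ℝ} (hr : 0 < r) (c : ℝ) :
    MemLp (fun y => f y - c) (ENNReal.ofReal p) (volume.restrict (ball x r)) := by
  have hp0 : 0 < p := by linarith
  have : IsFiniteMeasure (volume.restrict (ball x r)) :=
    ⟨by simpa using measure_ball_lt_top⟩
  have h1 : MemLp f (ENNReal.ofReal p) (volume.restrict (ball x r)) := by
    rw [← integrable_norm_rpow_iff hf.1.aestronglyMeasurable.restrict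
      (by simpa using hp0) ENNReal.ofReal_ne_top]
    have := hf.2 x r hr
    simpa [ENNReal.toReal_ofReal hp0.le, IntegrableOn] using this
  exact h1.sub (memLp_const c)

lemma memLp_bMeas {n : ℕ} {p : ℝ} (hp : 1 ≤ p) {f : EuclideanSpace ℝ (Fin n) → ℝ}
    (hf : MemLpLoc p f) (x : EuclideanSpace ℝ (Fin n)) {r : ℝ} (hr : 0 < r) (c : ℝ) :
    MemLp (fun y => f y - c) (ENNReal.ofReal p) (bMeas x r) :=
  (memLp_restrict hp hf x hr c).smul_measure
    (by simpa using (measure_ball_pos volume x hr).ne')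

lemma pMean_nonneg {n : ℕ} (p : ℝ) (f : EuclideanSpace ℝ (Fin n) → ℝ)
    (x : EuclideanSpace ℝ (Fin n)) (r c : ℝ) : 0 ≤ pMean p f x r c := by
  unfold pMean
  have : 0 ≤ ∫ y in ball x r, |f y - c| ^ p := integral_nonneg fun y => by positivity
  positivity

lemma pMean_eq {n : ℕ} {p : ℝ} (hp : 1 ≤ p) {f : EuclideanSpace ℝ (Fin n) → ℝ}
    (hf : MemLpLoc p f) (x : EuclideanSpace ℝ (Fin n)) {r : ℝ} (hr : 0 < r) (c : ℝ) :
    eLpNorm (fun y => f y - c) (ENNReal.ofReal p) (bMeas x r)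
      = ENNReal.ofReal (pMean p f x r c) := by
  have hp0 : 0 < p := by linarith
  rw [(memLp_bMeas hp hf x hr c).eLpNorm_eq_integral_rpow_norm (by simpa using hp0)
    ENNReal.ofReal_ne_top]
  simp [pMean, bMeas, ENNReal.toReal_ofReal hp0.le, integral_smul_measure]

lemma pMean_tri {n : ℕ} {p : ℝ} (hp : 1 ≤ p) {f : EuclideanSpace ℝ (Fin n) → ℝ}
    (hf : MemLpLoc p f) (x : EuclideanSpace ℝ (Fin n)) {r : ℝ} (hr : 0 < r) (c d : ℝ) :
    pMean p f x r c ≤ pMean p f x r d + |d - c| := by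
  have := bMeas_prob x hr
  have hp1 : 1 ≤ ENNReal.ofReal p := by simpa using hp
  have h := eLpNorm_add_le (memLp_bMeas hp hf x hr d).1
    (aestronglyMeasurable_const (b := d - c) (μ := bMeas x r)) hp1
  have e : ((fun y => f y - d) + fun _ => d - c) = fun y => f y - c := by
    ext y; simp
  rw [e, pMean_eq hp hf x hr, pMean_eq hp hf x hr, eLpNorm_const _ (by positivity) 
    (IsProbabilityMeasure.ne_zero _)] at h
  simp only [measure_univ, ENNReal.one_rpow, mul_one] at h
  rw [Real.enorm_eq_ofReal_abs, ← ENNReal.ofReal_add (pMean_nonneg ..) (abs_nonneg _)] at h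
  exact (ENNReal.ofReal_le_ofReal_iff (add_nonneg (pMean_nonneg ..) (abs_nonneg _))).1 h

lemma pMean_avg {n : ℕ} {p : ℝ} (hp : 1 ≤ p) {f : EuclideanSpace ℝ (Fin n) → ℝ}
    (hf : MemLpLoc p f) (x : EuclideanSpace ℝ (Fin n)) {r : ℝ} (hr : 0 < r) (c : ℝ) :
    |ballAvg f x r - c| ≤ pMean p f x r c := by
  have := bMeas_prob x hr
  have hp1 : 1 ≤ ENNReal.ofReal p := by simpa using hp
  have hL := memLp_bMeas hp hf x hr c
  have hL0 := memLp_bMeas hp hf x hr 0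
  have h1 := eLpNorm_le_eLpNorm_of_exponent_le hp1 hL.1
  rw [pMean_eq hp hf x hr, eLpNorm_one_eq_lintegral_enorm] at h1
  have e : ballAvg f x r - c = ∫ y, (f y - c) ∂(bMeas x r) := by
    have hi : Integrable f (bMeas x r) := by
      have := hL0.integrable hp1
      simpa using this
    rw [integral_sub hi (integrable_const c)]
    simp [ballAvg, bMeas, integral_smul_measure]
    have := vol_pos x hr
    rw [Measure.real, inv_mul_cancel₀ this.ne', one_mul]
  have h2 := (enorm_integral_le_lintegral_enorm (μ := bMeas x r) (fun y => f y - c)).trans h1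
  rw [← e, Real.enorm_eq_ofReal_abs] at h2
  exact (ENNReal.ofReal_le_ofReal_iff (pMean_nonneg ..)).1 h2

lemma pMean_mono {n : ℕ} {p : ℝ} (hp : 1 ≤ p) {f : EuclideanSpace ℝ (Fin n) → ℝ}
    (hf : MemLpLoc p f) (x y : EuclideanSpace ℝ (Fin n)) {r s : ℝ} (hr : 0 < r) (hs : 0 < s)
    (hsub : ball y s ⊆ ball x r) (h4 : r ≤ 4 * s) (c : ℝ) :
    pMean p f y s c ≤ 4 ^ n * pMean p f x r c := by
  have hp0 : 0 < p := by linarith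
  have hv : (volume (ball x r)).toReal ≤ 4 ^ n * (volume (ball y s)).toReal := by
    have h1 : volume (ball x r) ≤ volume (ball x (4 * s)) := measure_mono (ball_subset_ball h4)
    rw [Measure.addHaar_ball_mul_of_pos volume x (by norm_num : (0:ℝ) < 4) s,
      ← Measure.addHaar_ball_center volume y s] at h1
    have h2 := ENNReal.toReal_mono (by finiteness) h1
    simpa using h2
  have hvx := vol_pos x hr
  have hvy := vol_pos y hs
  have hint : IntegrableOn (fun z => |f z - c| ^ p) (ball x r) volume := by
    have := (memLp_restrict hp hf x hr c).integrable_norm_rpow (by simpa using hp0)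
      ENNReal.ofReal_ne_top
    simpa [ENNReal.toReal_ofReal hp0.le, IntegrableOn] using this
  have hI : ∫ z in ball y s, |f z - c| ^ p ≤ ∫ z in ball x r, |f z - c| ^ p :=
    setIntegral_mono_set hint (Eventually.of_forall fun z => by positivity)
      (Eventually.of_forall hsub)
  have hI0 : 0 ≤ ∫ z in ball y s, |f z - c| ^ p := integral_nonneg fun y => by positivity
  have hI1 := hI0.trans hI
  unfold pMean
  have hK : (1:ℝ) ≤ 4 ^ n := one_le_pow₀ (by norm_num)
  have hin : (volume (ball y s)).toReal⁻¹ ≤ 4 ^ n * (volume (ball x r)).toReal⁻¹ := by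
    rw [← div_eq_mul_inv, le_div_iff₀ hvx, inv_mul_le_iff₀ hvy, mul_comm]
    linarith
  calc _ ≤ (4 ^ n * ((volume (ball x r)).toReal⁻¹ * ∫ z in ball x r, |f z - c| ^ p)) ^ (1 / p) := by
        apply Real.rpow_le_rpow (by positivity) _ (by positivity)
        rw [← mul_assoc]
        exact mul_le_mul hin hI hI0 (by positivity)
    _ = (4 ^ n : ℝ) ^ (1 / p) * _ := Real.mul_rpow (by positivity) (by positivity)
    _ ≤ _ := by
        apply mul_le_mul_of_nonneg_right _ (by positivity)
        calc (4 ^ n : ℝ) ^ (1 / p) ≤ (4 ^ n : ℝ) ^ (1 : ℝ) :=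
              Real.rpow_le_rpow_of_exponent_le hK (by rw [div_le_one hp0]; exact hp)
          _ = _ := Real.rpow_one _

lemma dbl_le {n : ℕ} {A : ℝ} (hA : 0 < A) {φ : EuclideanSpace ℝ (Fin n) → ℝ → ℝ}
    (hpos : GrowthPos φ) (hD : DoublingWith A φ) (x : EuclideanSpace ℝ (Fin n)) {s t : ℝ}
    (hs : 0 < s) (ht : 0 < t) (h1 : s ≤ 2 * t) (h2 : t ≤ 2 * s) : φ x s ≤ A * φ x t := by
  have := (hD x t s ht hs (by rw [div_le_div_iff₀ (by norm_num) ht]; linarith)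
    (by rw [div_le_iff₀ ht]; linarith)).2
  rwa [div_le_iff₀ (hpos x t ht)] at this

lemma ii_phi {n : ℕ} {A : ℝ} (hA : 0 < A) {φ : EuclideanSpace ℝ (Fin n) → ℝ → ℝ}
    (hpos : GrowthPos φ) (hD : DoublingWith A φ)
    (hm : ∀ x : EuclideanSpace ℝ (Fin n), Measurable fun t => φ x t)
    (x : EuclideanSpace ℝ (Fin n)) {a b : ℝ} (ha : 0 < a) (hab : a ≤ b) :
    IntervalIntegrable (fun t => φ x t / t) volume a b := by
  have key : ∀ a b : ℝ, 0 < a → a ≤ b → b ≤ 2 * a →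
      IntervalIntegrable (fun t => φ x t / t) volume a b := by
    intro a b ha hab hb
    rw [intervalIntegrable_iff_integrableOn_Icc_of_le hab]
    refine Measure.integrableOn_of_bounded (M := A * φ x a / a) (by simp)
      ((hm x).div measurable_id).aestronglyMeasurable ?_
    refine (ae_restrict_iff' measurableSet_Icc).2 (Eventually.of_forall fun t ht => ?_)
    have ht0 : 0 < t := ha.trans_le ht.1
    have hp := hpos x t ht0
    rw [Real.norm_of_nonneg (by positivity)]
    have := dbl_le hA hpos hD x ht0 ha (by linarith [ht.2]) (by linarith [ht.1])
    have hpa := hpos x a ha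
    exact div_le_div₀ (by positivity) this ha ht.1
  have ind : ∀ k : ℕ, ∀ a b : ℝ, 0 < a → a ≤ b → b ≤ 2 ^ k * a →
      IntervalIntegrable (fun t => φ x t / t) volume a b := by
    intro k
    induction k with
    | zero =>
      intro a b ha hab hb
      exact key a b ha hab (by linarith [hb])
    | succ k ih =>
      intro a b ha hab hb
      by_cases h : b ≤ 2 * a
      · exact key a b ha hab h
      · push Not at h
        refine (key a (2 * a) ha (by linarith) le_rfl).trans
          (ih (2 * a) b (by linarith) h.le ?_)
        rw [pow_succ] at hb; linarith
  obtain ⟨k, hk⟩ := pow_unbounded_of_one_lt (b / a) (by norm_num : (1:ℝ) < 2)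
  exact ind k a b ha hab (by rw [div_lt_iff₀ ha] at hk; exact hk.le)

lemma int_nonneg {n : ℕ} {φ : EuclideanSpace ℝ (Fin n) → ℝ → ℝ}
    (hpos : GrowthPos φ) (x : EuclideanSpace ℝ (Fin n)) {a b : ℝ} (ha : 0 < a) (hab : a ≤ b) :
    0 ≤ ∫ t in a..b, φ x t / t :=
  intervalIntegral.integral_nonneg hab fun t ht =>
    div_nonneg (hpos x t (ha.trans_le ht.1)).le (ha.trans_le ht.1).le

lemma phi_le_int {n : ℕ} {A : ℝ} (hA : 0 < A) {φ : EuclideanSpace ℝ (Fin n) → ℝ → ℝ}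
    (hpos : GrowthPos φ) (hD : DoublingWith A φ)
    (hm : ∀ x : EuclideanSpace ℝ (Fin n), Measurable fun t => φ x t)
    (x : EuclideanSpace ℝ (Fin n)) {r s : ℝ} (hr : 0 < r) (h1 : r ≤ s) (h2 : s ≤ 2 * r) :
    φ x s ≤ 2 * A * ∫ t in r..(2 * r), φ x t / t := by
  have hs : 0 < s := by linarith
  have hps := hpos x s hs
  have h := intervalIntegral.integral_mono_on (μ := volume) (by linarith : r ≤ 2 * r)
    (intervalIntegrable_const (c := (A⁻¹ * φ x s) / (2 * r)))
    (ii_phi hA hpos hD hm x hr (by linarith : r ≤ 2 * r)) (fun t ht => by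
      have ht0 : 0 < t := hr.trans_le ht.1
      have := dbl_le hA hpos hD x hs ht0 (by linarith [ht.1]) (by linarith [ht.2])
      have hpt := hpos x t ht0
      refine div_le_div₀ hpt.le ?_ ht0 ht.2
      rwa [inv_mul_le_iff₀ hA])
  rw [intervalIntegral.integral_const, smul_eq_mul] at h
  have e : (2 * r - r) * (A⁻¹ * φ x s / (2 * r)) = φ x s / (2 * A) := by field_simp; ring
  rw [e, div_le_iff₀ (by positivity)] at h
  linarith

lemma chain {n : ℕ} {p : ℝ} (hp : 1 ≤ p) {A : ℝ} (hA : 0 < A)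
    {φ : EuclideanSpace ℝ (Fin n) → ℝ → ℝ}
    (hpos : GrowthPos φ) (hD : DoublingWith A φ)
    (hm : ∀ x : EuclideanSpace ℝ (Fin n), Measurable fun t => φ x t)
    {f : EuclideanSpace ℝ (Fin n) → ℝ} (hf : MemLpLoc p f) {M : ℝ} (hM : 0 ≤ M)
    (hE : ∀ x r, 0 < r → pMean p f x r (ballAvg f x r) ≤ M * φ x r)
    (x : EuclideanSpace ℝ (Fin n)) {R : ℝ} (hxR : ‖x‖ ≤ R) {r : ℝ} (hr : 0 < r) (hrR : r ≤ R) :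
    pMean p f x r (ballAvg f 0 (2 * R)) ≤ 4 ^ n * M * φ 0 (2 * R) +
      4 ^ n * M * (2 * A) * ∫ t in r..R, φ x t / t := by
  have hR : 0 < R := hr.trans_le hrR
  have ind : ∀ k : ℕ, ∀ r : ℝ, 0 < r → r ≤ R → R ≤ 2 ^ k * r →
      pMean p f x r (ballAvg f 0 (2 * R)) ≤ 4 ^ n * M * φ 0 (2 * R) +
      4 ^ n * M * (2 * A) * ∫ t in r..R, φ x t / t := by
    have base : ∀ r : ℝ, 0 < r → r ≤ R → R ≤ 2 * r →
      pMean p f x r (ballAvg f 0 (2 * R)) ≤ 4 ^ n * M * φ 0 (2 * R) +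
      4 ^ n * M * (2 * A) * ∫ t in r..R, φ x t / t := by
      intro r hr hrR h2
      have h1 := pMean_mono hp hf 0 x (by linarith : 0 < 2 * R) hr
        (ball_subset_ball' (by rw [dist_zero_right]; linarith)) (by linarith)
        (ballAvg f 0 (2 * R))
      have h3 := mul_le_mul_of_nonneg_left (hE 0 (2 * R) (by linarith))
        (by positivity : (0:ℝ) ≤ 4 ^ n)
      have h4 := int_nonneg hpos x hr hrR
      have h5 : 0 ≤ 4 ^ n * M * (2 * A) * ∫ t in r..R, φ x t / t := by positivity
      linarith
    intro k
    induction k with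
    | zero =>
      intro r hr hrR h
      exact base r hr hrR (by linarith)
    | succ k ih =>
      intro r hr hrR h
      by_cases h2 : R ≤ 2 * r
      · exact base r hr hrR h2
      · push Not at h2
        have i1 := ih (2 * r) (by linarith) h2.le (by rw [pow_succ] at h; linarith)
        have i2 := pMean_tri hp hf x hr (ballAvg f 0 (2 * R)) (ballAvg f x (2 * r))
        have i3 := pMean_avg hp hf x (by linarith : 0 < 2 * r) (ballAvg f 0 (2 * R))
        have i4 := pMean_mono hp hf x x (by linarith : 0 < 2 * r) hr
          (ball_subset_ball (by linarith)) (by linarith) (ballAvg f x (2 * r))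
        have i5 := mul_le_mul_of_nonneg_left (hE x (2 * r) (by linarith))
          (by positivity : (0:ℝ) ≤ 4 ^ n)
        have i6 := mul_le_mul_of_nonneg_left
          (phi_le_int hA hpos hD hm x hr (by linarith : r ≤ 2 * r) le_rfl)
          (by positivity : (0:ℝ) ≤ 4 ^ n * M)
        have i7 := intervalIntegral.integral_add_adjacent_intervals
          (ii_phi hA hpos hD hm x hr (by linarith : r ≤ 2 * r))
          (ii_phi hA hpos hD hm x (by linarith : 0 < 2 * r) h2.le)
        rw [← i7]
        linarith
  obtain ⟨k, hk⟩ := pow_unbounded_of_one_lt (R / r) (by norm_num : (1:ℝ) < 2)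
  exact ind k r hr hrR (by rw [div_lt_iff₀ hr] at hk; exact hk.le)

/-- The continuous inclusion `𝓛𝓝_{p,φ}(ℝⁿ) ⊆ L_{p,Φ*+Φ**}(ℝⁿ)`:
`‖f‖_{L_{p,Φ*+Φ**}} ≤ C ‖f‖_{𝓛𝓝_{p,φ}}`. -/
theorem campanato_subset_morrey (n : ℕ) (p : ℝ) (hp : 1 ≤ p)
    (φ : EuclideanSpace ℝ (Fin n) → ℝ → ℝ) (hpos : GrowthPos φ) (hD : Doubling φ)
    (hm : ∀ x : EuclideanSpace ℝ (Fin n), Measurable fun t => φ x t) :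
    ∃ C > 0, ∀ f : EuclideanSpace ℝ (Fin n) → ℝ, MemLpLoc p f → campNorm p φ f < ⊤ →
      morreyNorm p (fun x r => PhiStar φ x r + PhiStarStar φ x r) f ≤
        ENNReal.ofReal C * campNorm p φ f := by
  obtain ⟨A, hA, hD⟩ := hD
  have hφ1 := hpos 0 1 one_pos
  set K : ℝ := 4 ^ n with hK
  have hK0 : 0 < K := by positivity
  -- constants
  set C : ℝ := 2 * K * (2 * A) * A + 2 * (K * (2 * A)) + 2 * A / φ 0 1 with hC
  refine ⟨C * 1, by positivity, fun f hf hfin => ?_⟩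
  rw [mul_one]
  set M := (campSemi p φ f).toReal with hMdef
  have hM : 0 ≤ M := ENNReal.toReal_nonneg
  have hS : campSemi p φ f ≠ ⊤ := by
    intro h
    simp [campNorm, h] at hfin
  have hE : ∀ x r, 0 < r → pMean p f x r (ballAvg f x r) ≤ M * φ x r := by
    intro x r hr
    have h1 : ENNReal.ofReal ((φ x r)⁻¹ * pMean p f x r (ballAvg f x r)) ≤ campSemi p φ f := by
      unfold campSemi
      exact le_iSup_of_le x (le_iSup_of_le r (le_iSup_of_le hr le_rfl))
    have h2 := (ENNReal.ofReal_le_iff_le_toReal hS).1 h1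
    rwa [inv_mul_le_iff₀ (hpos x r hr), mul_comm] at h2
  set a := |ballAvg f 0 1| with ha
  have ha0 : 0 ≤ a := abs_nonneg _
  have hN : campNorm p φ f = ENNReal.ofReal (M + a) := by
    rw [ENNReal.ofReal_add hM ha0, hMdef, ENNReal.ofReal_toReal hS]; rfl
  rw [hN, ← ENNReal.ofReal_mul (by positivity)]
  refine iSup_le fun x => iSup_le fun r => iSup_le fun hr => ENNReal.ofReal_le_ofReal ?_
  have e0 : ((volume (ball x r)).toReal⁻¹ * ∫ y in ball x r, |f y| ^ p) ^ (1 / p)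
      = pMean p f x r 0 := by simp [pMean]
  rw [e0]
  simp only [PhiStar, PhiStarStar]
  set R := max 2 (max ‖x‖ r) with hR
  have hR2 : 2 ≤ R := le_max_left _ _
  have hxR : ‖x‖ ≤ R := (le_max_left _ _).trans (le_max_right _ _)
  have hrR : r ≤ R := (le_max_right _ _).trans (le_max_right _ _)
  have c1 := chain hp hA hpos hD hm hf hM hE x hxR hr hrR
  have c2 := chain hp hA hpos hD hm hf hM hE 0 (by simp; linarith : ‖(0 : EuclideanSpace ℝ (Fin n))‖ ≤ R)
    one_pos (by linarith : 1 ≤ R)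
  have t1 := pMean_tri hp hf x hr 0 (ballAvg f 0 (2 * R))
  rw [sub_zero] at t1
  have t2 := pMean_avg hp hf 0 one_pos (ballAvg f 0 (2 * R))
  have t3 : |ballAvg f 0 (2 * R)| ≤ a + |ballAvg f 0 1 - ballAvg f 0 (2 * R)| := by
    have := abs_sub (ballAvg f 0 1) (ballAvg f 0 1 - ballAvg f 0 (2 * R))
    rwa [sub_sub_cancel] at this
  have n2 := int_nonneg hpos x hr hrR
  have n1 := int_nonneg hpos 0 one_pos (by linarith : 1 ≤ R)
  -- lower bounds for the first integral
  have l1 : φ 0 1 ≤ 2 * A * ∫ t in (1:ℝ)..R, φ 0 t / t := by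
    have h := phi_le_int hA hpos hD hm 0 one_pos (le_refl 1) (by norm_num)
    rw [mul_one] at h
    have h7 := intervalIntegral.integral_add_adjacent_intervals
          (ii_phi hA hpos hD hm 0 one_pos (by norm_num : (1:ℝ) ≤ 2))
          (ii_phi hA hpos hD hm 0 (by norm_num : (0:ℝ) < 2) hR2)
    have h8 := int_nonneg hpos 0 (by norm_num : (0:ℝ) < 2) hR2
    refine h.trans (mul_le_mul_of_nonneg_left (by linarith) (by positivity))
  have l2 : φ 0 (2 * R) ≤ A * (2 * A * ∫ t in (1:ℝ)..R, φ 0 t / t) := by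
    have h0 := dbl_le hA hpos hD 0 (by linarith : 0 < 2 * R) (by linarith : 0 < R) le_rfl
      (by linarith)
    have h := phi_le_int hA hpos hD hm 0 (by linarith : 0 < R / 2) (by linarith : R / 2 ≤ R)
      (by linarith)
    rw [mul_div_cancel₀ R (two_ne_zero)] at h
    have h7 := intervalIntegral.integral_add_adjacent_intervals
          (ii_phi hA hpos hD hm 0 one_pos (by linarith : (1:ℝ) ≤ R / 2))
          (ii_phi hA hpos hD hm 0 (by linarith : (0:ℝ) < R / 2) (by linarith : R / 2 ≤ R))
    have h8 := int_nonneg hpos 0 one_pos (by linarith : (1:ℝ) ≤ R / 2)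
    refine h0.trans (mul_le_mul_of_nonneg_left (h.trans ?_) hA.le)
    exact mul_le_mul_of_nonneg_left (by linarith) (by positivity)
  set I1 := ∫ t in (1:ℝ)..R, φ 0 t / t
  set I2 := ∫ t in r..R, φ x t / t
  have hI1 : 0 < I1 := by
    by_contra hcon
    have : I1 = 0 := le_antisymm (not_lt.1 hcon) n1
    rw [this] at l1; linarith
  rw [inv_mul_le_iff₀ (by positivity)]
  have l3 : a ≤ a * (2 * A / φ 0 1 * I1) := by
    apply le_mul_of_one_le_right ha0
    rw [div_mul_eq_mul_div, one_le_div hφ1]; exact l1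
  have l4 := mul_le_mul_of_nonneg_left l2 (by positivity : 0 ≤ K * M)
  have total : pMean p f x r 0 ≤ 2 * (K * M * (A * (2 * A * I1))) + K * M * (2 * A) * I2
      + K * M * (2 * A) * I1 + a * (2 * A / φ 0 1 * I1) := by linarith
  refine total.trans ?_
  set D := 2 * A / φ 0 1
  have hD0 : 0 < D := by positivity
  have : (I1 + I2) * (C * (M + a)) - (2 * (K * M * (A * (2 * A * I1))) + K * M * (2 * A) * I2
      + K * M * (2 * A) * I1 + a * (D * I1)) =
      I2 * (2 * K * (2 * A) * A + D) * M + I2 * (K * (2 * A)) * M + I1 * (K * (2 * A)) * M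
      + I1 * D * M + I2 * C * a + I1 * (2 * K * (2 * A) * A + 2 * (K * (2 * A))) * a := by
    rw [hC]; ring
  have h9 : 0 ≤ I2 * (2 * K * (2 * A) * A + D) * M + I2 * (K * (2 * A)) * M + I1 * (K * (2 * A)) * M
      + I1 * D * M + I2 * C * a + I1 * (2 * K * (2 * A) * A + 2 * (K * (2 * A))) * a := by
    positivity
  linarith

end
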